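/- arXiv:math/9908065 — 3 statements merged into one kernel-verified Lean document; each statement's English description precedes it below -/
import Mathlib

section
/- Define a sequence of real numbers (a_j)_{j≥0} by a_0 = 1 and the Newton-type recursion (j+1)·a_{j+1} = ∑_{k=0}^{j} (−1)^k P(k+1) a_{j−k}, where P(1) = γ is the Euler–Mascheroni constant and P(k) = ζ(k) for k ≥ 2. Then for every complex number z, the series ∑_{j=0}^{∞} a_j z^j converges and equals 1/Γ(1+z). (Equivalently: the homomorphism ζ on symmetric functions sending the power sum p_1 to γ and p_k to ζ(k) for k ≥ 2 satisfies ζ(∑_{j≥0} e_j z^j) = 1/Γ(1+z).) -/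
open Complex Metric Filter Topology Finset
open scoped Nat

/-- The `m`-th logarithmic term (for `m + 1`) of the Weierstrass product of `1 / Γ(1 + z)`. -/
noncomputable def logTerm (m : ℕ) (z : ℂ) : ℂ :=
  log (1 + z / (m + 1)) - z / (m + 1)

/-- The derivative of `logTerm m`. -/
noncomputable def logTermDeriv (m : ℕ) (z : ℂ) : ℂ :=
  (m + 1 + z)⁻¹ - ((m : ℂ) + 1)⁻¹

lemma norm_natCast_add_one (m : ℕ) : ‖(m : ℂ) + 1‖ = m + 1 := by
  exact_mod_cast Complex.norm_natCast (m + 1)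

lemma norm_div_natCast_add_one_lt {z : ℂ} (hz : z ∈ ball (0 : ℂ) (1 / 2)) (m : ℕ) :
    ‖z / ((m : ℂ) + 1)‖ < 1 / 2 := by
  rw [norm_div, norm_natCast_add_one]
  rw [mem_ball_zero_iff] at hz
  refine lt_of_le_of_lt (div_le_self (norm_nonneg z) ?_) hz
  linarith [(Nat.cast_nonneg m : (0 : ℝ) ≤ m)]

lemma one_add_div_mem_slitPlane {z : ℂ} (hz : z ∈ ball (0 : ℂ) (1 / 2)) (m : ℕ) :
    1 + z / ((m : ℂ) + 1) ∈ slitPlane :=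
  mem_slitPlane_of_norm_lt_one (by linarith [norm_div_natCast_add_one_lt hz m])

lemma natCast_add_one_add_ne_zero {z : ℂ} (hz : z ∈ ball (0 : ℂ) (1 / 2)) (m : ℕ) :
    (m : ℂ) + 1 + z ≠ 0 := by
  have h0 : (m : ℂ) + 1 ≠ 0 := Nat.cast_add_one_ne_zero m
  have h1 := slitPlane_ne_zero (one_add_div_mem_slitPlane hz m)
  contrapose! h1
  field_simp
  rw [h1, mul_zero]

lemma hasDerivAt_logTerm {z : ℂ} (hz : z ∈ ball (0 : ℂ) (1 / 2)) (m : ℕ) :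
    HasDerivAt (logTerm m) (logTermDeriv m z) z := by
  have h0 : (m : ℂ) + 1 ≠ 0 := Nat.cast_add_one_ne_zero m
  have h1 := natCast_add_one_add_ne_zero hz m
  have hd : HasDerivAt (fun s : ℂ ↦ s / ((m : ℂ) + 1)) (1 / (m + 1)) z :=
    (hasDerivAt_id z).div_const _
  have h := ((hd.const_add 1).clog (one_add_div_mem_slitPlane hz m)).sub hd
  convert! h using 1
  rw [logTermDeriv]
  have h2 : 1 + z / ((m : ℂ) + 1) = (m + 1 + z) / (m + 1) := by field_simp
  rw [h2]
  field_simp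

lemma hasSum_logTermDeriv {z : ℂ} (hz : z ∈ ball (0 : ℂ) (1 / 2)) (m : ℕ) :
    HasSum (fun k : ℕ ↦ (-z) ^ (k + 1) * (1 / ((m : ℂ) + 1) ^ (k + 2))) (logTermDeriv m z) := by
  have h0 : (m : ℂ) + 1 ≠ 0 := Nat.cast_add_one_ne_zero m
  have h1 := natCast_add_one_add_ne_zero hz m
  have h2 : 1 + z / ((m : ℂ) + 1) = (m + 1 + z) / (m + 1) := by field_simp
  have h := (hasSum_geometric_of_norm_lt_one (ξ := -(z / ((m : ℂ) + 1)))
    (by rw [norm_neg]; linarith [norm_div_natCast_add_one_lt hz m])).mul_left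
      (-z / ((m : ℂ) + 1) ^ 2)
  rw [sub_neg_eq_add, h2] at h
  convert! h using 1
  · ext k
    rw [← neg_div, div_pow]
    field_simp
    ring
  · rw [logTermDeriv]
    field_simp
    ring

lemma summable_one_div_natCast_add_one_sq :
    Summable fun m : ℕ ↦ 1 / ((m : ℝ) + 1) ^ 2 := by
  exact_mod_cast (summable_nat_add_iff 1).mpr (Real.summable_one_div_nat_pow.mpr one_lt_two)

lemma norm_logTermDeriv_le {z : ℂ} (hz : z ∈ ball (0 : ℂ) (1 / 2)) (m : ℕ) :
    ‖logTermDeriv m z‖ ≤ 1 / ((m : ℝ) + 1) ^ 2 := by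
  have hm : (0 : ℝ) ≤ m := Nat.cast_nonneg m
  have h0 : (m : ℂ) + 1 ≠ 0 := Nat.cast_add_one_ne_zero m
  have h1 := natCast_add_one_add_ne_zero hz m
  rw [mem_ball_zero_iff] at hz
  have h2 : logTermDeriv m z = -z / ((m + 1 + z) * (m + 1)) := by
    rw [logTermDeriv]
    field_simp
    ring
  have h3 : ((m : ℝ) + 1) / 2 ≤ ‖(m : ℂ) + 1 + z‖ := by
    have := norm_sub_le_norm_add ((m : ℂ) + 1) z
    rw [norm_natCast_add_one] at this
    linarith
  rw [h2, norm_div, norm_mul, norm_neg, norm_natCast_add_one,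
    div_le_div_iff₀ (by positivity) (by positivity)]
  nlinarith [mul_le_mul_of_nonneg_right h3 (by positivity : (0 : ℝ) ≤ (m : ℝ) + 1),
    mul_le_mul_of_nonneg_right hz.le (by positivity : (0 : ℝ) ≤ ((m : ℝ) + 1) ^ 2)]

lemma summable_neg_pow_mul_one_div_pow {z : ℂ} (hz : ‖z‖ < 1) :
    Summable fun q : ℕ × ℕ ↦ (-z) ^ (q.2 + 1) * (1 / ((q.1 : ℂ) + 1) ^ (q.2 + 2)) := by
  have hgeo : Summable fun k : ℕ ↦ ‖z‖ ^ (k + 1) :=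
    (summable_nat_add_iff 1).mpr (summable_geometric_of_lt_one (norm_nonneg z) hz)
  have hprod : Summable fun q : ℕ × ℕ ↦ 1 / ((q.1 : ℝ) + 1) ^ 2 * ‖z‖ ^ (q.2 + 1) :=
    summable_one_div_natCast_add_one_sq.mul_of_nonneg hgeo
      (fun m ↦ by positivity) fun k ↦ by positivity
  refine .of_norm_bounded hprod fun ⟨m, k⟩ ↦ ?_
  have hm : (1 : ℝ) ≤ (m : ℝ) + 1 := by linarith [(Nat.cast_nonneg m : (0 : ℝ) ≤ m)]
  simp only [norm_mul, norm_pow, norm_neg, norm_div, norm_one, norm_natCast_add_one]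
  rw [mul_comm]
  gcongr
  omega

lemma hasSum_one_div_natCast_add_one_pow (k : ℕ) :
    HasSum (fun m : ℕ ↦ 1 / ((m : ℂ) + 1) ^ (k + 2)) (riemannZeta ((k + 2 : ℕ) : ℂ)) := by
  have hk : 1 < ((k + 2 : ℕ) : ℂ).re := by
    rw [natCast_re]
    exact_mod_cast (by omega : 1 < k + 2)
  rw [zeta_eq_tsum_one_div_nat_add_one_cpow hk]
  simp only [cpow_natCast]
  refine Summable.hasSum (.of_norm_bounded summable_one_div_natCast_add_one_sq fun m ↦ ?_)
  have hm : (1 : ℝ) ≤ (m : ℝ) + 1 := by linarith [(Nat.cast_nonneg m : (0 : ℝ) ≤ m)]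
  rw [norm_div, norm_pow, norm_one, norm_natCast_add_one]
  gcongr
  omega

lemma hasSum_riemannZeta_mul_neg_pow {z : ℂ} (hz : z ∈ ball (0 : ℂ) (1 / 2)) :
    HasSum (fun k : ℕ ↦ (-z) ^ (k + 1) * riemannZeta ((k + 2 : ℕ) : ℂ))
      (∑' m, logTermDeriv m z) := by
  have hz' : ‖z‖ < 1 := by
    rw [mem_ball_zero_iff] at hz
    linarith
  have hsum := (summable_neg_pow_mul_one_div_pow hz').hasSum
  rw [(hsum.prod_fiberwise fun m ↦ hasSum_logTermDeriv hz m).tsum_eq]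
  have hswap := (Equiv.prodComm ℕ ℕ).hasSum_iff.mpr hsum
  have hfib (k : ℕ) := (hasSum_one_div_natCast_add_one_pow k).mul_left ((-z) ^ (k + 1))
  generalize (∑' q : ℕ × ℕ, (-z) ^ (q.2 + 1) * (1 / ((q.1 : ℂ) + 1) ^ (q.2 + 2))) = A
    at hswap ⊢
  exact hswap.prod_fiberwise hfib

lemma summable_logTerm_zero : Summable fun m ↦ logTerm m 0 := by
  simp [logTerm, summable_zero]

lemma summable_logTerm {z : ℂ} (hz : z ∈ ball (0 : ℂ) (1 / 2)) :
    Summable fun m ↦ logTerm m z :=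
  summable_of_summable_hasDerivAt_of_isPreconnected summable_one_div_natCast_add_one_sq
    isOpen_ball (convex_ball _ _).isPreconnected (fun m _ hy ↦ hasDerivAt_logTerm hy m)
    (fun m _ hy ↦ norm_logTermDeriv_le hy m) (mem_ball_self (by norm_num))
    summable_logTerm_zero hz

lemma hasDerivAt_tsum_logTerm {z : ℂ} (hz : z ∈ ball (0 : ℂ) (1 / 2)) :
    HasDerivAt (fun s ↦ ∑' m, logTerm m s) (∑' m, logTermDeriv m z) z :=
  hasDerivAt_tsum_of_isPreconnected summable_one_div_natCast_add_one_sq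
    isOpen_ball (convex_ball _ _).isPreconnected (fun m _ hy ↦ hasDerivAt_logTerm hy m)
    (fun m _ hy ↦ norm_logTermDeriv_le hy m) (mem_ball_self (by norm_num))
    summable_logTerm_zero hz

lemma prod_one_add_add_natCast {z : ℂ} (hz : z ∈ ball (0 : ℂ) (1 / 2)) (n : ℕ) :
    ∏ j ∈ range n, (1 + z + j) =
      n ! * exp (∑ m ∈ range n, logTerm m z + z * (harmonic n : ℝ)) := by
  induction n with
  | zero => simp
  | succ n ih =>
    have h0 : (n : ℂ) + 1 ≠ 0 := Nat.cast_add_one_ne_zero n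
    have h1 : exp (log (1 + z / ((n : ℂ) + 1))) = 1 + z / (n + 1) :=
      exp_log (slitPlane_ne_zero (one_add_div_mem_slitPlane hz n))
    have h2 : ∑ m ∈ range (n + 1), logTerm m z + z * ((harmonic (n + 1) : ℝ) : ℂ) =
        (∑ m ∈ range n, logTerm m z + z * (harmonic n : ℝ)) + log (1 + z / ((n : ℂ) + 1)) := by
      rw [sum_range_succ, harmonic_succ, logTerm]
      push_cast
      ring
    rw [prod_range_succ, ih, h2, exp_add _ (log _), h1, Nat.factorial_succ]
    push_cast
    field_simp
    ring

lemma inv_GammaSeq_one_add {z : ℂ} (hz : z ∈ ball (0 : ℂ) (1 / 2)) {n : ℕ} (hn : n ≠ 0) :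
    (GammaSeq (1 + z) n)⁻¹ =
      exp (∑ m ∈ range n, logTerm m z + z * ((harmonic n - Real.log n : ℝ) : ℂ)) *
        ((n : ℂ) / (n + (1 + z)))⁻¹ := by
  have hn' : (n : ℂ) ≠ 0 := Nat.cast_ne_zero.mpr hn
  have hfac : (n ! : ℂ) ≠ 0 := Nat.cast_ne_zero.mpr n.factorial_ne_zero
  have h1 : ∑ m ∈ range n, logTerm m z + z * ((harmonic n - Real.log n : ℝ) : ℂ) =
      (∑ m ∈ range n, logTerm m z + z * (harmonic n : ℝ)) - log n * z := by
    rw [ofReal_sub, ← natCast_log]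
    ring
  have h2 : (n : ℂ) ^ (1 + z) = n * exp (log n * z) := by
    rw [cpow_add _ _ hn', cpow_one, cpow_def_of_ne_zero hn']
  rw [GammaSeq, prod_range_succ, prod_one_add_add_natCast hz, h1, h2, exp_sub, inv_div, inv_div,
    add_comm (n : ℂ) (1 + z)]
  have h3 := exp_ne_zero (log n * z)
  field_simp

/-- The logarithm of the Weierstrass product of `1 / Γ(1 + z)` near the origin. -/
lemma one_div_Gamma_one_add_eq_exp {z : ℂ} (hz : z ∈ ball (0 : ℂ) (1 / 2)) :
    1 / Gamma (1 + z) = exp (∑' m, logTerm m z + z * Real.eulerMascheroniConstant) := by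
  have hne : Gamma (1 + z) ≠ 0 := by
    refine Gamma_ne_zero_of_re_pos ?_
    rw [mem_ball_zero_iff] at hz
    rw [add_re, one_re]
    linarith [neg_le_of_abs_le (abs_re_le_norm z)]
  have hlim := (GammaSeq_tendsto_Gamma (1 + z)).inv₀ hne
  have h1 : Tendsto (fun n : ℕ ↦ ((harmonic n - Real.log n : ℝ) : ℂ)) atTop
      (𝓝 (Real.eulerMascheroniConstant : ℂ)) :=
    (continuous_ofReal.tendsto _).comp Real.tendsto_harmonic_sub_log
  have h2 := ((continuous_exp.tendsto _).comp
    ((summable_logTerm hz).hasSum.tendsto_sum_nat.add (h1.const_mul z))).mul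
      ((tendsto_natCast_div_add_atTop (1 + z)).inv₀ one_ne_zero)
  rw [inv_one, mul_one] at h2
  rw [one_div]
  refine tendsto_nhds_unique hlim (h2.congr' ?_)
  filter_upwards [eventually_ne_atTop 0] with n hn
  exact (inv_GammaSeq_one_add hz hn).symm

lemma hasDerivAt_one_div_Gamma_one_add {z : ℂ} (hz : z ∈ ball (0 : ℂ) (1 / 2)) :
    HasDerivAt (fun s : ℂ ↦ 1 / Gamma (1 + s))
      ((Real.eulerMascheroniConstant + ∑' m, logTermDeriv m z) * (1 / Gamma (1 + z))) z := by
  have h := ((hasDerivAt_tsum_logTerm hz).add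
    ((hasDerivAt_id z).mul_const (Real.eulerMascheroniConstant : ℂ))).cexp
  rw [one_div_Gamma_one_add_eq_exp hz]
  refine (h.congr_deriv ?_).congr_of_eventuallyEq ?_
  · simp only [Pi.add_apply, id_eq]
    ring
  · filter_upwards [isOpen_ball.mem_nhds hz] with s hs
    exact one_div_Gamma_one_add_eq_exp hs

lemma differentiable_one_div_Gamma_one_add :
    Differentiable ℂ fun s : ℂ ↦ 1 / Gamma (1 + s) := by
  simp only [one_div]
  exact differentiable_one_div_Gamma.comp ((differentiable_const 1).add differentiable_id)

/-- If `F' = G * F` near the origin with `G = ∑ p k z ^ k`, then a sequence satisfying the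
corresponding recursion with initial value `F 0` is the sequence of Taylor coefficients of `F`. -/
lemma eq_taylorCoeff_of_deriv_eq_mul {F G : ℂ → ℂ} {p c : ℕ → ℂ} (hF : AnalyticAt ℂ F 0)
    (h0 : c 0 = F 0)
    (hG : ∀ᶠ z in 𝓝 0, HasSum (fun k : ℕ ↦ p k * z ^ k) (G z))
    (hFG : ∀ᶠ z in 𝓝 0, deriv F z = G z * F z)
    (hc : ∀ j : ℕ, ((j : ℂ) + 1) * c (j + 1) = ∑ k ∈ range (j + 1), p k * c (j - k)) (j : ℕ) :
    c j = iteratedDeriv j F 0 / j ! := by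
  have hGs : HasFPowerSeriesAt G (FormalMultilinearSeries.ofScalars ℂ p) 0 := by
    rw [hasFPowerSeriesAt_iff']
    filter_upwards [hG] with z hz
    simpa [FormalMultilinearSeries.coeff_ofScalars, mul_comm] using hz
  have hGa : AnalyticAt ℂ G 0 := hGs.analyticAt
  have hGd (k : ℕ) : iteratedDeriv k G 0 = k ! * p k := by
    have h := congrArg (fun q ↦ FormalMultilinearSeries.coeff q k)
      (hGs.eq_formalMultilinearSeries hGa.hasFPowerSeriesAt)
    simp only [FormalMultilinearSeries.coeff_ofScalars] at h
    rw [h, mul_div_cancel₀ _ (Nat.cast_ne_zero.mpr k.factorial_ne_zero)]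
  induction j using Nat.strong_induction_on with
  | _ j ih =>
    cases j with
    | zero => simpa using h0
    | succ j =>
      have h1 : (j : ℂ) + 1 ≠ 0 := Nat.cast_add_one_ne_zero j
      have h2 : (j ! : ℂ) ≠ 0 := Nat.cast_ne_zero.mpr j.factorial_ne_zero
      have hrec : iteratedDeriv (j + 1) F 0 = j ! * ∑ k ∈ range (j + 1), p k * c (j - k) := by
        rw [iteratedDeriv_succ', EventuallyEq.iteratedDeriv_eq j hFG,
          iteratedDeriv_fun_mul hGa.contDiffAt hF.contDiffAt, mul_sum]
        refine sum_congr rfl fun k hk ↦ ?_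
        have hkj : k ≤ j := by
          rw [mem_range] at hk
          omega
        rw [ih (j - k) (by omega), hGd, ← Nat.choose_mul_factorial_mul_factorial hkj]
        have h3 : ((j - k)! : ℂ) ≠ 0 := Nat.cast_ne_zero.mpr (j - k).factorial_ne_zero
        push_cast
        field_simp
      rw [hrec, ← hc, Nat.factorial_succ]
      push_cast
      field_simp

/-- Let `a 0 = 1` and `(j+1) a_{j+1} = ∑_{k=0}^{j} (-1)^k P(k+1) a_{j-k}` where
`P 1 = γ` (Euler–Mascheroni) and `P k = ζ(k)` for `k ≥ 2`.  Then for every complex `z`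
the series `∑_j a_j z^j` converges to `1/Γ(1+z)`. -/
theorem stmt_1 (P : ℕ → ℝ)
    (hP1 : P 1 = Real.eulerMascheroniConstant)
    (hPk : ∀ k : ℕ, 2 ≤ k → (P k : ℂ) = riemannZeta k)
    (a : ℕ → ℝ) (ha0 : a 0 = 1)
    (harec : ∀ j : ℕ, ((j : ℝ) + 1) * a (j + 1)
      = ∑ k ∈ Finset.range (j + 1), (-1 : ℝ) ^ k * P (k + 1) * a (j - k)) :
    ∀ z : ℂ, HasSum (fun j : ℕ => (a j : ℂ) * z ^ j) (1 / Complex.Gamma (1 + z)) := by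
  have hP : (P 1 : ℂ) = Real.eulerMascheroniConstant := by rw [hP1]
  have hent := differentiable_one_div_Gamma_one_add
  obtain ⟨G, hG, hFG⟩ : ∃ G : ℂ → ℂ,
      (∀ z ∈ ball (0 : ℂ) (1 / 2),
        HasSum (fun k : ℕ ↦ (-1 : ℂ) ^ k * P (k + 1) * z ^ k) (G z)) ∧
      ∀ z ∈ ball (0 : ℂ) (1 / 2), HasDerivAt (fun s : ℂ ↦ 1 / Gamma (1 + s))
        (G z * (1 / Gamma (1 + z))) z := by
    refine ⟨fun z ↦ Real.eulerMascheroniConstant + ∑' m, logTermDeriv m z, fun z hz ↦ ?_,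
      fun z hz ↦ hasDerivAt_one_div_Gamma_one_add hz⟩
    have h : HasSum (fun k : ℕ ↦ (-1 : ℂ) ^ (k + 1) * P (k + 1 + 1) * z ^ (k + 1))
        (∑' m, logTermDeriv m z) := by
      refine (hasSum_riemannZeta_mul_neg_pow hz).congr_fun fun k ↦ ?_
      rw [hPk (k + 1 + 1) (by omega), neg_pow z]
      ring
    simpa [hP] using h.zero_add (f := fun k : ℕ ↦ (-1 : ℂ) ^ k * P (k + 1) * z ^ k)
  have hball : ball (0 : ℂ) (1 / 2) ∈ 𝓝 0 := ball_mem_nhds 0 (by norm_num)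
  have hcoeff : ∀ j : ℕ, (a j : ℂ) = iteratedDeriv j (fun s : ℂ ↦ 1 / Gamma (1 + s)) 0 / j ! :=
    eq_taylorCoeff_of_deriv_eq_mul (hent.analyticAt 0) (by simp [ha0])
      (p := fun k ↦ (-1 : ℂ) ^ k * P (k + 1))
      (eventually_of_mem hball hG) (eventually_of_mem hball fun z hz ↦ (hFG z hz).deriv)
      fun j ↦ by exact_mod_cast congrArg (Complex.ofReal) (harec j)
  intro z
  convert! Complex.hasSum_taylorSeries_of_entire hent 0 z using 2 with j
  rw [hcoeff]
  simp only [sub_zero, smul_eq_mul]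
  ring
end

section
/- For every real number z with |z| < 1, one has log Γ(1+z) = −γ z + ∑_{k=2}^{∞} (−1)^k ζ(k) z^k / k, where the series on the right converges. -/
open Filter Topology

/-- The tail of the logarithm series, `w - log (1 + w) = w²/2 - w³/3 + ⋯`. -/
theorem hasSum_sub_log_one_add {w : ℝ} (hw : |w| < 1) :
    HasSum (fun k : ℕ => (-1 : ℝ) ^ (k + 2) * w ^ (k + 2) / (k + 2)) (w - Real.log (1 + w)) := by
  have h := Real.hasSum_pow_div_log_of_abs_lt_one (x := -w) (by rwa [abs_neg])
  have h' := (hasSum_nat_add_iff' 1).mpr h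
  convert! h' using 1
  · ext k
    rw [neg_pow w]
    push_cast
    ring_nf
  · simp
    ring

theorem hasSum_riemannZeta_nat_re {m : ℕ} (hm : 1 < m) :
    HasSum (fun n : ℕ => 1 / ((n : ℝ) + 1) ^ m) (riemannZeta m).re := by
  have hs : Summable (fun n : ℕ => 1 / ((n : ℝ) + 1) ^ m) := by
    have := (summable_nat_add_iff 1).mpr (Real.summable_one_div_nat_pow.mpr hm)
    simpa using this
  have hz : riemannZeta m = ((∑' n : ℕ, 1 / ((n : ℝ) + 1) ^ m : ℝ) : ℂ) := by
    rw [zeta_eq_tsum_one_div_nat_add_one_cpow (by simpa using hm)]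
    push_cast
    simp only [Complex.cpow_natCast]
  rw [hz, Complex.ofReal_re]
  exact hs.hasSum

theorem tendsto_sum_div_sub_log_one_add_div {z : ℝ} (hz : |z| < 1) :
    Tendsto (fun N : ℕ => ∑ n ∈ Finset.range N,
        (z / ((n : ℝ) + 1) - Real.log (1 + z / ((n : ℝ) + 1)))) atTop
      (𝓝 (Real.log (Real.Gamma (1 + z)) + Real.eulerMascheroniConstant * z)) := by
  have hz' : 0 < 1 + z := by linarith [(abs_lt.mp hz).1]
  rw [← tendsto_add_atTop_iff_nat 1]
  have hharm := (tendsto_add_atTop_iff_nat 1).mpr Real.tendsto_harmonic_sub_log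
  have h := ((Real.BohrMollerup.tendsto_log_gamma hz').add (hharm.mul_const z)).add
    (Real.tendsto_log_nat_add_one_sub_log.const_mul (1 + z))
  rw [mul_zero, add_zero] at h
  refine h.congr fun n => ?_
  have hterm : ∀ m : ℕ, Real.log (1 + z / ((m : ℝ) + 1))
      = Real.log (1 + z + m) - Real.log ((m : ℝ) + 1) := fun m => by
    have hm : (0 : ℝ) < m + 1 := by positivity
    have hm' : 0 < 1 + z + (m : ℝ) := by positivity
    rw [← Real.log_div hm'.ne' hm.ne']
    congr 1
    field_simp
    ring
  have hfact : ∀ N : ℕ, ∑ m ∈ Finset.range N, Real.log ((m : ℝ) + 1)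
      = Real.log (N.factorial : ℝ) := fun N => by
    rw [← Finset.prod_range_add_one_eq_factorial, Nat.cast_prod, Real.log_prod]
    · simp
    · intro i _
      positivity
  have hH : ((harmonic (n + 1) : ℚ) : ℝ) * z
      = ∑ m ∈ Finset.range (n + 1), z / ((m : ℝ) + 1) := by
    rw [harmonic, Rat.cast_sum, Finset.sum_mul]
    refine Finset.sum_congr rfl fun m _ => ?_
    push_cast
    ring
  have hf : Real.log ((n + 1).factorial : ℝ) = Real.log ((n : ℝ) + 1) + Real.log n.factorial := by
    rw [Nat.factorial_succ, Nat.cast_mul, Real.log_mul (by positivity) (by positivity)]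
    simp
  simp only [hterm, Finset.sum_sub_distrib, hfact, hf, ← hH, Real.BohrMollerup.logGammaSeq]
  push_cast
  ring

/-- For real `z` with `|z| < 1`,
`log Γ(1+z) = -γ z + ∑_{k=2}^∞ (-1)^k ζ(k) z^k / k`, the series converging.
Stated as: the series `∑_{k≥0} (-1)^{k+2} ζ(k+2) z^{k+2}/(k+2)` has sum
`log Γ(1+z) + γ z`. -/
theorem stmt_2 (z : ℝ) (hz : |z| < 1) :
    HasSum
      (fun k : ℕ => (-1 : ℝ) ^ (k + 2) * (riemannZeta (k + 2)).re * z ^ (k + 2) / (k + 2))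
      (Real.log (Real.Gamma (1 + z)) + Real.eulerMascheroniConstant * z) := by
  let F : ℕ × ℕ → ℝ := fun p =>
    (-1 : ℝ) ^ (p.2 + 2) * (z / ((p.1 : ℝ) + 1)) ^ (p.2 + 2) / (p.2 + 2)
  have hF : Summable F := by
    have h1 := (hasSum_riemannZeta_nat_re one_lt_two).summable
    have h2 := summable_geometric_of_lt_one (abs_nonneg z) hz
    refine .of_norm_bounded (h1.mul_of_nonneg h2 (fun n => by positivity)
      (fun k => by positivity)) fun p => ?_
    obtain ⟨n, k⟩ := p
    have hn : (1 : ℝ) ≤ (n : ℝ) + 1 := by simp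
    have hk : (1 : ℝ) ≤ (k : ℝ) + 2 := by linarith [k.cast_nonneg (α := ℝ)]
    simp only [F, norm_div, norm_mul, norm_pow, norm_neg, norm_one, one_pow, one_mul,
      Real.norm_eq_abs]
    rw [abs_of_pos (show (0 : ℝ) < (k : ℝ) + 2 by positivity),
      abs_of_pos (show (0 : ℝ) < (n : ℝ) + 1 by positivity)]
    refine (div_le_self (by positivity) hk).trans ?_
    rw [div_pow, div_eq_mul_one_div, mul_comm]
    gcongr ?_ * ?_
    · gcongr 1 / ?_
      exact pow_le_pow_right₀ hn (by lia)
    · exact pow_le_pow_of_le_one (abs_nonneg z) hz.le (by lia)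
  have hrow : ∀ n : ℕ, HasSum (fun k => F (n, k))
      (z / ((n : ℝ) + 1) - Real.log (1 + z / ((n : ℝ) + 1))) := fun n => by
    have hw : |z / ((n : ℝ) + 1)| < 1 := by
      rw [abs_div, abs_of_pos (show (0 : ℝ) < (n : ℝ) + 1 by positivity)]
      exact (div_le_self (abs_nonneg z) (by simp)).trans_lt hz
    simpa only [F] using hasSum_sub_log_one_add hw
  have hcol : ∀ k : ℕ, HasSum (fun n => F (n, k))
      ((-1 : ℝ) ^ (k + 2) * (riemannZeta (k + 2)).re * z ^ (k + 2) / (k + 2)) := fun k => by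
    have h := (hasSum_riemannZeta_nat_re (show 1 < k + 2 by lia)).mul_left
      ((-1 : ℝ) ^ (k + 2) * z ^ (k + 2) / (k + 2))
    push_cast at h
    convert! h using 1
    · ext n
      simp only [F, div_pow]
      ring
    · ring
  have hsum := hF.hasSum.prod_fiberwise hrow
  have hval := tendsto_nhds_unique hsum.tendsto_sum_nat (tendsto_sum_div_sub_log_one_add_div hz)
  rw [← hval]
  exact ((Equiv.prodComm ℕ ℕ).hasSum_iff.mpr hF.hasSum).prod_fiberwise hcol
end

section
/- The third Taylor coefficient at 0 of the entire function z ↦ 1/Γ(1+z) equals ζ(3)/3 − γ ζ(2)/2 + γ³/6; that is, (1/3!) times the third derivative of z ↦ 1/Γ(1+z) at 0 equals ζ(3)/3 − γ ζ(2)/2 + γ³/6. (This corrects the coefficient of c_1³ in formula (1.5) of Libgober's paper: the coefficient of c_1³ in Q_3 is ⅓ζ(3) − ½γζ(2) + ⅙γ³.) -/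
open Filter Topology Metric

namespace Complex

/-- The terms of the Weierstrass series of `-log Γ(1+z) - γ z`. -/
noncomputable def weierstrassLogTerm (n : ℕ) (z : ℂ) : ℂ :=
  log (1 + z / (n + 1)) - z / (n + 1)

lemma norm_inv_natCast_add_one_add_le {z : ℂ} (hz : z ∈ ball (0 : ℂ) (1 / 2)) (n : ℕ) :
    ‖((n : ℂ) + 1 + z)⁻¹‖ ≤ 2 / ((n : ℝ) + 1) := by
  have hz' : ‖z‖ < 1 / 2 := by simpa using hz
  have hn : ‖(n : ℂ) + 1‖ = n + 1 := by exact_mod_cast norm_natCast (n + 1)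
  have h : ‖(n : ℂ) + 1‖ - ‖z‖ ≤ ‖(n : ℂ) + 1 + z‖ := norm_sub_le_norm_add _ _
  have hn0 : (0 : ℝ) ≤ n := n.cast_nonneg
  rw [norm_inv, ← inv_div]
  exact inv_anti₀ (by positivity) (by linarith)

lemma natCast_add_one_add_ne_zero {z : ℂ} (hz : z ∈ ball (0 : ℂ) (1 / 2)) (n : ℕ) :
    (n : ℂ) + 1 + z ≠ 0 := by
  have hz' : ‖z‖ < 1 / 2 := by simpa using hz
  intro h
  have hn : ‖(n : ℂ) + 1‖ = n + 1 := by exact_mod_cast norm_natCast (n + 1)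
  rw [eq_neg_of_add_eq_zero_left h, norm_neg] at hn
  linarith [(n.cast_nonneg : (0 : ℝ) ≤ n)]

lemma one_add_div_natCast_add_one_mem_slitPlane {z : ℂ} (hz : z ∈ ball (0 : ℂ) (1 / 2)) (n : ℕ) :
    1 + z / (n + 1) ∈ slitPlane := by
  have hz' : ‖z‖ < 1 / 2 := by simpa using hz
  apply mem_slitPlane_of_norm_lt_one
  have hn : ‖(n : ℂ) + 1‖ = n + 1 := by exact_mod_cast norm_natCast (n + 1)
  rw [norm_div, hn, div_lt_one (by positivity)]
  linarith [(n.cast_nonneg : (0 : ℝ) ≤ n)]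

lemma summable_const_div_natCast_add_one_sq (c : ℝ) :
    Summable fun n : ℕ ↦ c / ((n : ℝ) + 1) ^ 2 := by
  have h := (summable_nat_add_iff 1).2 (Real.summable_one_div_nat_pow.2 one_lt_two)
  simpa [div_eq_mul_inv] using h.mul_left c

lemma hasDerivAt_weierstrassLogTerm {z : ℂ} (hz : z ∈ ball (0 : ℂ) (1 / 2)) (n : ℕ) :
    HasDerivAt (weierstrassLogTerm n) (((n : ℂ) + 1 + z)⁻¹ - ((n : ℂ) + 1)⁻¹) z := by
  have hn : (n : ℂ) + 1 ≠ 0 := n.cast_add_one_ne_zero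
  have hd := (hasDerivAt_id z).div_const ((n : ℂ) + 1)
  refine (((hd.const_add 1).clog (one_add_div_natCast_add_one_mem_slitPlane hz n)).sub
    hd).congr_deriv ?_
  have h := natCast_add_one_add_ne_zero hz n
  have h' := slitPlane_ne_zero (one_add_div_natCast_add_one_mem_slitPlane hz n)
  simp only [id]
  rw [show 1 + z / ((n : ℂ) + 1) = ((n : ℂ) + 1 + z) / (n + 1) by field_simp]
  field_simp

lemma norm_inv_sub_inv_le {z : ℂ} (hz : z ∈ ball (0 : ℂ) (1 / 2)) (n : ℕ) :
    ‖((n : ℂ) + 1 + z)⁻¹ - ((n : ℂ) + 1)⁻¹‖ ≤ 1 / ((n : ℝ) + 1) ^ 2 := by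
  have hz' : ‖z‖ < 1 / 2 := by simpa using hz
  have hn : ‖(n : ℂ) + 1‖ = n + 1 := by exact_mod_cast norm_natCast (n + 1)
  have hn0 : (n : ℂ) + 1 ≠ 0 := n.cast_add_one_ne_zero
  have h := natCast_add_one_add_ne_zero hz n
  rw [show ((n : ℂ) + 1 + z)⁻¹ - ((n : ℂ) + 1)⁻¹ = -(z * ((n : ℂ) + 1 + z)⁻¹ / (n + 1)) by
    field_simp; ring, norm_neg, norm_div, norm_mul, hn]
  calc ‖z‖ * ‖((n : ℂ) + 1 + z)⁻¹‖ / ((n : ℝ) + 1)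
      ≤ 1 / 2 * (2 / ((n : ℝ) + 1)) / ((n : ℝ) + 1) := by
        gcongr
        exact norm_inv_natCast_add_one_add_le hz n
    _ = 1 / ((n : ℝ) + 1) ^ 2 := by field_simp

lemma summable_weierstrassLogTerm {z : ℂ} (hz : z ∈ ball (0 : ℂ) (1 / 2)) :
    Summable fun n ↦ weierstrassLogTerm n z :=
  summable_of_summable_hasDerivAt_of_isPreconnected (summable_const_div_natCast_add_one_sq 1)
    isOpen_ball (convex_ball _ _).isPreconnected (fun n _ hy ↦ hasDerivAt_weierstrassLogTerm hy n)
    (fun n _ hy ↦ norm_inv_sub_inv_le hy n) (mem_ball_self (by norm_num))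
    (by simp [weierstrassLogTerm]) hz

lemma hasDerivAt_tsum_weierstrassLogTerm {z : ℂ} (hz : z ∈ ball (0 : ℂ) (1 / 2)) :
    HasDerivAt (fun z ↦ ∑' n, weierstrassLogTerm n z)
      (∑' n : ℕ, (((n : ℂ) + 1 + z)⁻¹ - ((n : ℂ) + 1)⁻¹)) z :=
  hasDerivAt_tsum_of_isPreconnected (summable_const_div_natCast_add_one_sq 1)
    isOpen_ball (convex_ball _ _).isPreconnected (fun n _ hy ↦ hasDerivAt_weierstrassLogTerm hy n)
    (fun n _ hy ↦ norm_inv_sub_inv_le hy n) (mem_ball_self (by norm_num))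
    (by simp [weierstrassLogTerm]) hz

lemma norm_inv_sq_le {z : ℂ} (hz : z ∈ ball (0 : ℂ) (1 / 2)) (n : ℕ) :
    ‖-(((n : ℂ) + 1 + z) ^ 2)⁻¹‖ ≤ 4 / ((n : ℝ) + 1) ^ 2 := by
  rw [norm_neg, ← inv_pow, norm_pow]
  calc _ ≤ (2 / ((n : ℝ) + 1)) ^ 2 := by
        gcongr
        exact norm_inv_natCast_add_one_add_le hz n
    _ = _ := by rw [div_pow]; norm_num

lemma hasDerivAt_tsum_inv_sub_inv {z : ℂ} (hz : z ∈ ball (0 : ℂ) (1 / 2)) :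
    HasDerivAt (fun z ↦ ∑' n : ℕ, (((n : ℂ) + 1 + z)⁻¹ - ((n : ℂ) + 1)⁻¹))
      (∑' n : ℕ, -(((n : ℂ) + 1 + z) ^ 2)⁻¹) z := by
  refine hasDerivAt_tsum_of_isPreconnected (summable_const_div_natCast_add_one_sq 4)
    isOpen_ball (convex_ball _ _).isPreconnected (fun n y hy ↦ ?_)
    (fun n _ hy ↦ norm_inv_sq_le hy n) (mem_ball_self (by norm_num)) (by simp) hz
  refine ((((hasDerivAt_id y).const_add ((n : ℂ) + 1)).inv
    (natCast_add_one_add_ne_zero hy n)).sub_const _).congr_deriv ?_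
  simp [neg_div]

lemma norm_inv_cube_le {z : ℂ} (hz : z ∈ ball (0 : ℂ) (1 / 2)) (n : ℕ) :
    ‖2 * (((n : ℂ) + 1 + z) ^ 3)⁻¹‖ ≤ 16 / ((n : ℝ) + 1) ^ 2 := by
  rw [← inv_pow, norm_mul, norm_pow, norm_ofNat]
  calc _ ≤ 2 * (2 / ((n : ℝ) + 1)) ^ 3 := by
        gcongr
        exact norm_inv_natCast_add_one_add_le hz n
    _ = 16 / ((n : ℝ) + 1) ^ 3 := by rw [div_pow]; ring
    _ ≤ _ := by
        gcongr
        · simp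
        · norm_num

lemma hasDerivAt_tsum_neg_inv_sq {z : ℂ} (hz : z ∈ ball (0 : ℂ) (1 / 2)) :
    HasDerivAt (fun z ↦ ∑' n : ℕ, -(((n : ℂ) + 1 + z) ^ 2)⁻¹)
      (∑' n : ℕ, 2 * (((n : ℂ) + 1 + z) ^ 3)⁻¹) z := by
  have h0 : (0 : ℂ) ∈ ball (0 : ℂ) (1 / 2) := mem_ball_self (by norm_num)
  refine hasDerivAt_tsum_of_isPreconnected (summable_const_div_natCast_add_one_sq 16)
    isOpen_ball (convex_ball _ _).isPreconnected (fun n y hy ↦ ?_)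
    (fun n _ hy ↦ norm_inv_cube_le hy n) h0
    (.of_norm_bounded (summable_const_div_natCast_add_one_sq 4) (norm_inv_sq_le h0)) hz
  have h := natCast_add_one_add_ne_zero hy n
  refine ((((hasDerivAt_id y).const_add ((n : ℂ) + 1)).pow 2).inv
    (pow_ne_zero 2 h)).neg.congr_deriv ?_
  simp only [id, Pi.pow_apply]
  field_simp
  push_cast
  ring

/-- The Weierstrass product of `1/Γ(1+z)`, in exponential form, near `0`. -/
lemma one_div_Gamma_one_add_eq_exp {z : ℂ} (hz : z ∈ ball (0 : ℂ) (1 / 2)) :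
    1 / Gamma (1 + z) = exp (Real.eulerMascheroniConstant * z + ∑' n, weierstrassLogTerm n z) := by
  have hprod (N : ℕ) : exp (∑ k ∈ Finset.range N, weierstrassLogTerm k z) =
      (∏ k ∈ Finset.range N, (1 + z + k)) / N.factorial * exp (-(z * (harmonic N : ℝ))) := by
    induction N with
    | zero => simp
    | succ N ih =>
      have hN : (N : ℂ) + 1 ≠ 0 := N.cast_add_one_ne_zero
      have hf : (N.factorial : ℂ) ≠ 0 := by exact_mod_cast N.factorial_ne_zero
      rw [Finset.sum_range_succ, exp_add, ih, Finset.prod_range_succ, weierstrassLogTerm,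
        sub_eq_add_neg, exp_add,
        exp_log (slitPlane_ne_zero (one_add_div_natCast_add_one_mem_slitPlane hz N)),
        harmonic_succ, Nat.factorial_succ]
      push_cast
      rw [mul_add z (harmonic N : ℂ), neg_add, exp_add, ← div_eq_mul_inv]
      field_simp
      ring
  have hL : Tendsto (fun N : ℕ ↦ exp (Real.eulerMascheroniConstant * z +
      ∑ k ∈ Finset.range (N + 1), weierstrassLogTerm k z)) atTop
      (𝓝 (exp (Real.eulerMascheroniConstant * z + ∑' n, weierstrassLogTerm n z))) :=
    (((summable_weierstrassLogTerm hz).hasSum.tendsto_sum_nat.comp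
      (tendsto_add_atTop_nat 1)).const_add _).cexp
  have hγ : Tendsto (fun N : ℕ ↦ ((harmonic (N + 1) - Real.log N : ℝ) : ℂ)) atTop
      (𝓝 (Real.eulerMascheroniConstant : ℂ)) := by
    refine (continuous_ofReal.tendsto _).comp ?_
    have h := Real.tendsto_harmonic_sub_log.add
      (tendsto_one_div_add_atTop_nhds_zero_nat (𝕜 := ℝ))
    rw [add_zero] at h
    refine h.congr fun N ↦ ?_
    rw [harmonic_succ]
    push_cast
    ring
  have hE : Tendsto (fun N : ℕ ↦ exp (Real.eulerMascheroniConstant * z -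
      z * ((harmonic (N + 1) - Real.log N : ℝ) : ℂ))) atTop (𝓝 1) := by
    have h := ((hγ.const_mul z).const_sub (Real.eulerMascheroniConstant * z)).cexp
    rwa [mul_comm z, sub_self, exp_zero] at h
  have hGne : Gamma (1 + z) ≠ 0 := Gamma_ne_zero fun m h ↦
    natCast_add_one_add_ne_zero hz m (by rw [add_assoc, h]; ring)
  have hR := ((tendsto_natCast_div_add_atTop (1 : ℂ)).mul
    ((GammaSeq_tendsto_Gamma (1 + z)).inv₀ hGne)).mul hE
  rw [one_mul, mul_one, ← one_div] at hR
  refine tendsto_nhds_unique (hR.congr' ?_) hL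
  filter_upwards [eventually_ne_atTop 0] with N hN
  have hN0 : (N : ℂ) ≠ 0 := by exact_mod_cast hN
  have hN1 : (N : ℂ) + 1 ≠ 0 := N.cast_add_one_ne_zero
  have hf : (N.factorial : ℂ) ≠ 0 := by exact_mod_cast N.factorial_ne_zero
  rw [exp_add, hprod, GammaSeq, cpow_add _ _ hN0, cpow_one, cpow_def_of_ne_zero hN0, sub_eq_add_neg,
    exp_add, ofReal_sub, mul_sub, neg_sub, sub_eq_add_neg, exp_add, natCast_log, mul_comm z (log N),
    Nat.factorial_succ, inv_div]
  have he := exp_ne_zero (log N * z)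
  push_cast
  field_simp

lemma riemannZeta_natCast_eq_tsum_inv {k : ℕ} (hk : 1 < k) :
    riemannZeta k = ∑' n : ℕ, (((n : ℂ) + 1) ^ k)⁻¹ := by
  rw [zeta_eq_tsum_one_div_nat_add_one_cpow (by simpa using hk)]
  simp

/-- The third derivative of `1/Γ(1+z)` at `0`. -/
lemma iteratedDeriv_three_one_div_Gamma_one_add :
    iteratedDeriv 3 (fun z : ℂ ↦ 1 / Gamma (1 + z)) 0 =
      2 * riemannZeta 3 - 3 * Real.eulerMascheroniConstant * riemannZeta 2 +
        (Real.eulerMascheroniConstant : ℂ) ^ 3 := by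
  set U := ball (0 : ℂ) (1 / 2)
  have hU : IsOpen U := isOpen_ball
  have h0 : (0 : ℂ) ∈ U := mem_ball_self (by norm_num)
  set c := (Real.eulerMascheroniConstant : ℂ)
  set G₁ : ℂ → ℂ := fun z ↦ ∑' n : ℕ, (((n : ℂ) + 1 + z)⁻¹ - ((n : ℂ) + 1)⁻¹)
  set G₂ : ℂ → ℂ := fun z ↦ ∑' n : ℕ, -(((n : ℂ) + 1 + z) ^ 2)⁻¹
  set F : ℂ → ℂ := fun z ↦ 1 / Gamma (1 + z)
  have hG₁ (z) (hz : z ∈ U) : HasDerivAt G₁ (G₂ z) z := hasDerivAt_tsum_inv_sub_inv hz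
  have hF (z) (hz : z ∈ U) : HasDerivAt F ((c + G₁ z) * F z) z := by
    have h := (((hasDerivAt_id z).const_mul c).add (hasDerivAt_tsum_weierstrassLogTerm hz)).cexp
    refine (h.congr_of_eventuallyEq ?_).congr_deriv ?_
    · filter_upwards [hU.mem_nhds hz] with w hw using one_div_Gamma_one_add_eq_exp hw
    · simp only [F, one_div_Gamma_one_add_eq_exp hz, mul_one]
      exact mul_comm _ _
  have hF₁ (z) (hz : z ∈ U) : HasDerivAt (fun z ↦ (c + G₁ z) * F z)
      ((G₂ z + (c + G₁ z) ^ 2) * F z) z :=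
    (((hG₁ z hz).const_add c).mul (hF z hz)).congr_deriv (by ring)
  have hF₂ := ((hasDerivAt_tsum_neg_inv_sq h0).add (((hG₁ 0 h0).const_add c).pow 2)).mul (hF 0 h0)
  have e₁ : U.EqOn (deriv F) fun z ↦ (c + G₁ z) * F z := fun z hz ↦ (hF z hz).deriv
  have e₂ : U.EqOn (deriv (deriv F)) fun z ↦ (G₂ z + (c + G₁ z) ^ 2) * F z := fun z hz ↦
    ((e₁.eventuallyEq_of_mem (hU.mem_nhds hz)).deriv_eq).trans (hF₁ z hz).deriv
  have e₃ := ((e₂.eventuallyEq_of_mem (hU.mem_nhds h0)).deriv_eq).trans hF₂.deriv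
  have hz2 : G₂ 0 = -riemannZeta 2 := by
    have h := riemannZeta_natCast_eq_tsum_inv one_lt_two
    simp only [G₂, add_zero, tsum_neg]
    exact_mod_cast congrArg Neg.neg h.symm
  have hz3 : ∑' n : ℕ, 2 * (((n : ℂ) + 1 + 0) ^ 3)⁻¹ = 2 * riemannZeta 3 := by
    have h := riemannZeta_natCast_eq_tsum_inv (k := 3) (by norm_num)
    simp only [add_zero, tsum_mul_left]
    exact_mod_cast congrArg (2 * ·) h.symm
  have hG0 : G₁ 0 = 0 := by simp [G₁]
  have hF0 : F 0 = 1 := by simp [F]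
  rw [iteratedDeriv_eq_iterate]
  refine e₃.trans ?_
  simp only [Pi.add_apply, Pi.pow_apply]
  rw [hz3, show (∑' n : ℕ, -(((n : ℂ) + 1 + 0) ^ 2)⁻¹) = G₂ 0 from rfl, hz2, hG0, hF0]
  push_cast
  ring

end Complex

/-- The third Taylor coefficient at `0` of `z ↦ 1/Γ(1+z)` equals
`ζ(3)/3 - γ ζ(2)/2 + γ³/6`:
`(1/3!) · (d³/dz³)|₀ (1/Γ(1+z)) = ζ(3)/3 - γ ζ(2)/2 + γ³/6`. -/
theorem stmt_5 :
    (1 / (Nat.factorial 3 : ℂ)) *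
        iteratedDeriv 3 (fun z : ℂ => 1 / Complex.Gamma (1 + z)) 0
      = riemannZeta 3 / 3
        - (Real.eulerMascheroniConstant : ℂ) * riemannZeta 2 / 2
        + (Real.eulerMascheroniConstant : ℂ) ^ 3 / 6 := by
  rw [Complex.iteratedDeriv_three_one_div_Gamma_one_add]
  norm_num [Nat.factorial]
  ring
end
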